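/- Let G be a connected k-regular bipartite finite simple graph on n vertices, and suppose 0 < λ(G) < k, where λ(G) is the largest absolute value among the eigenvalues μ of the adjacency matrix of G with |μ| < k. Then the diameter of G satisfies diam(G) ≤ 2 + log(n) / log((k + √(k² − λ(G)²)) / λ(G)). -/

import Mathlib

/-- `μ` is an eigenvalue of the (real) adjacency matrix of the graph `G`. -/
def IsAdjEigenvalue {V : Type*} [Fintype V] (G : SimpleGraph V) [DecidableRel G.Adj]
    (μ : ℝ) : Prop :=
  ∃ x : V → ℝ, x ≠ 0 ∧ (G.adjMatrix ℝ).mulVec x = μ • x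

/-- A graph is bipartite if its vertex set splits into two parts with all edges going
between the parts. -/
def IsBipartite {V : Type*} (G : SimpleGraph V) : Prop :=
  ∃ s : Set V, ∀ ⦃u v⦄, G.Adj u v → (u ∈ s ↔ v ∉ s)

open Matrix Polynomial in
/-- The value of a polynomial in `A` at an eigenvector of `A`. -/
theorem Matrix.aeval_mulVec_of_mulVec_eq_smul {V R : Type*} [Fintype V] [DecidableEq V]
    [CommRing R] {A : Matrix V V R} {x : V → R} {μ : R} (h : A *ᵥ x = μ • x) (q : R[X]) :
    aeval A q *ᵥ x = q.eval μ • x := by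
  induction q using Polynomial.induction_on' with
  | add p q hp hq => simp [add_mulVec, add_smul, hp, hq]
  | monomial n a =>
    have hpow : A ^ n *ᵥ x = μ ^ n • x := by
      induction n with
      | zero => simp
      | succ n ih => rw [pow_succ, ← mulVec_mulVec, h, mulVec_smul, ih, smul_smul, pow_succ']
    rw [aeval_monomial, eval_monomial, ← mulVec_mulVec, hpow, Algebra.algebraMap_eq_smul_one,
      smul_mulVec, one_mulVec, smul_smul]

open Matrix Polynomial in
/-- Polynomials in a symmetric matrix are symmetric. -/
theorem Matrix.IsSymm.aeval {V R : Type*} [Fintype V] [DecidableEq V] [CommRing R]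
    {A : Matrix V V R} (h : A.IsSymm) (q : R[X]) : (aeval A q).IsSymm := by
  induction q using Polynomial.induction_on' with
  | add p q hp hq => simpa using hp.add hq
  | monomial n a =>
    rw [aeval_monomial, Algebra.algebraMap_eq_smul_one, smul_one_mul]
    exact (h.pow n).smul a

open Matrix Polynomial in
/-- If `|q| ≤ 1` on all eigenvalues of a real symmetric matrix `A` having an eigenvector not
orthogonal to `w`, then `q(A)` does not increase the norm of `w`. -/
theorem Matrix.IsSymm.aeval_mulVec_dotProduct_self_le {V : Type*} [Fintype V] [DecidableEq V]
    {A : Matrix V V ℝ} (hA : A.IsSymm) (q : ℝ[X]) (w : V → ℝ)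
    (hq : ∀ (μ : ℝ) (x : V → ℝ), x ≠ 0 → A *ᵥ x = μ • x → |q.eval μ| ≤ 1 ∨ x ⬝ᵥ w = 0) :
    (Polynomial.aeval A q *ᵥ w) ⬝ᵥ (Polynomial.aeval A q *ᵥ w) ≤ w ⬝ᵥ w := by
  have hH : A.IsHermitian := by rwa [IsHermitian, conjTranspose_eq_transpose_of_trivial]
  have key (y : V → ℝ) : y ⬝ᵥ y = ∑ i, ((hH.eigenvectorBasis i).ofLp ⬝ᵥ y) ^ 2 := by
    have h := hH.eigenvectorBasis.sum_sq_norm_inner_right (WithLp.toLp 2 y)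
    rw [EuclideanSpace.real_norm_sq_eq] at h
    simp only [dotProduct, ← sq]
    rw [← h]
    refine Finset.sum_congr rfl fun i _ ↦ ?_
    simp [PiLp.inner_apply, mul_comm]
  rw [key, key w]
  refine Finset.sum_le_sum fun i _ ↦ ?_
  have hi := hH.mulVec_eigenvectorBasis i
  have hne : (hH.eigenvectorBasis i).ofLp ≠ 0 := by
    simpa using hH.eigenvectorBasis.orthonormal.ne_zero i
  rw [dotProduct_mulVec, ← mulVec_transpose, (hA.aeval q).eq,
    aeval_mulVec_of_mulVec_eq_smul hi, smul_dotProduct, smul_eq_mul, mul_pow]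
  rcases hq _ _ hne hi with h | h
  · exact mul_le_of_le_one_left (sq_nonneg _) ((sq_le_one_iff_abs_le_one _).2 h)
  · simp [h]

/-- Half of the `m`-th power of `t + √(t² - 1)` is at most the value of the `m`-th Chebyshev
polynomial at `t ≥ 1`. -/
theorem Polynomial.Chebyshev.pow_le_two_mul_eval_T {t : ℝ} (ht : 1 ≤ t) (m : ℕ) :
    (t + √(t ^ 2 - 1)) ^ m ≤ 2 * (T ℝ m).eval t := by
  have hs : 0 ≤ t ^ 2 - 1 := by nlinarith
  have hx : 0 < t + √(t ^ 2 - 1) := by positivity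
  set x := t + √(t ^ 2 - 1) with hxdef
  have hinv : x⁻¹ = t - √(t ^ 2 - 1) := by
    refine inv_eq_of_mul_eq_one_right ?_
    linear_combination -Real.sq_sqrt hs
  have hcosh : Real.cosh (Real.log x) = t := by
    rw [Real.cosh_log hx, hinv]; ring
  have h := T_real_cosh (Real.log x) m
  rw [hcosh, Int.cast_natCast, ← Real.log_pow, Real.cosh_log (by positivity)] at h
  rw [h]
  have : 0 < (x ^ m)⁻¹ := by positivity
  linarith

namespace SimpleGraph

open Matrix Polynomial

variable {V : Type*} [Fintype V] {G : SimpleGraph V} [DecidableRel G.Adj]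

/-- Polynomials in the adjacency matrix of degree less than the distance between `u` and `v`
vanish at the entry `(u, v)`. -/
theorem aeval_adjMatrix_apply_eq_zero [DecidableEq V] {u v : V} {q : ℝ[X]}
    (h : q.natDegree < G.dist u v) : aeval (G.adjMatrix ℝ) q u v = 0 := by
  rw [aeval_eq_sum_range, Matrix.sum_apply]
  refine Finset.sum_eq_zero fun i hi ↦ ?_
  rw [Matrix.smul_apply, adjMatrix_pow_apply_eq_card_walk]
  have : IsEmpty {p : G.Walk u v | p.length = i} := by
    refine ⟨fun ⟨p, hp⟩ ↦ ?_⟩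
    have := G.dist_le p
    simp only [Set.mem_ofPred_eq] at hp
    simp only [Finset.mem_range] at hi
    omega
  simp

section Regular

variable {k : ℕ} (hreg : G.IsRegularOfDegree k)
include hreg

theorem IsRegularOfDegree.lapMatrix_mulVec [DecidableEq V] (x : V → ℝ) :
    G.lapMatrix ℝ *ᵥ x = (k : ℝ) • x - G.adjMatrix ℝ *ᵥ x := by
  ext v
  simp [lapMatrix_mulVec_apply, hreg.degree_eq v]

/-- Eigenvalues of a `k`-regular graph are at most `k`. -/
theorem IsRegularOfDegree.eigenvalue_le {x : V → ℝ} {μ : ℝ} (hx : x ≠ 0)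
    (h : G.adjMatrix ℝ *ᵥ x = μ • x) : μ ≤ k := by
  classical
  have h0 := (posSemidef_lapMatrix ℝ G).dotProduct_mulVec_nonneg x
  rw [star_trivial, hreg.lapMatrix_mulVec, h, ← sub_smul, dotProduct_smul, smul_eq_mul] at h0
  have hpos : 0 < x ⬝ᵥ x := by
    simpa using dotProduct_star_self_pos_iff.2 hx
  have := nonneg_of_mul_nonneg_left h0 hpos
  linarith

/-- Eigenvectors of a connected `k`-regular graph for the eigenvalue `k` are constant. -/
theorem IsRegularOfDegree.eq_of_mulVec_eq_smul (hconn : G.Connected) {x : V → ℝ}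
    (h : G.adjMatrix ℝ *ᵥ x = (k : ℝ) • x) (u v : V) : x u = x v := by
  classical
  refine (lapMatrix_mulVec_eq_zero_iff_forall_reachable G).1 ?_ u v (hconn.preconnected u v)
  rw [hreg.lapMatrix_mulVec, h, sub_self]

end Regular

/-- A sign vector alternating along edges turns eigenvectors for `μ` into eigenvectors
for `-μ`. -/
theorem adjMatrix_mulVec_mul_of_alternating {σ : V → ℝ} (hadj : ∀ ⦃u v⦄, G.Adj u v → σ v = -σ u)
    {x : V → ℝ} {μ : ℝ} (h : G.adjMatrix ℝ *ᵥ x = μ • x) :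
    G.adjMatrix ℝ *ᵥ (σ * x) = (-μ) • (σ * x) := by
  ext v
  have hv := congrFun h v
  simp only [adjMatrix_mulVec_apply, Pi.smul_apply, Pi.mul_apply, smul_eq_mul] at hv ⊢
  have : ∑ u ∈ G.neighborFinset v, σ u * x u = ∑ u ∈ G.neighborFinset v, -σ v * x u :=
    Finset.sum_congr rfl fun u hu ↦ by rw [hadj ((G.mem_neighborFinset v u).1 hu)]
  rw [this, ← Finset.mul_sum, hv]
  ring

omit [Fintype V] [DecidableRel G.Adj] in
theorem Walk.alternating_eq {σ : V → ℝ} (hadj : ∀ ⦃u v⦄, G.Adj u v → σ v = -σ u) {u v : V}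
    (p : G.Walk u v) : σ v = (-1) ^ p.length * σ u := by
  induction p with
  | nil => simp
  | cons h p ih => rw [ih, hadj h, Walk.length_cons, pow_succ]; ring

/-- If `q` is bounded by `1` at the eigenvalues of absolute value less than `k`, then the `±k`
eigenspaces contribute at most `n` to an entry of `q(A)` beyond the degree of `q`. -/
theorem IsRegularOfDegree.abs_eval_add_eval_neg_le [DecidableEq V] {k : ℕ}
    (hreg : G.IsRegularOfDegree k) (hk : 0 < k) (hconn : G.Connected) {σ : V → ℝ}
    (hsq : ∀ v, σ v * σ v = 1)
    (hadj : ∀ ⦃u v⦄, G.Adj u v → σ v = -σ u) {q : ℝ[X]}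
    (hq : ∀ μ, IsAdjEigenvalue G μ → |μ| < k → |q.eval μ| ≤ 1) {u v : V}
    (huv : q.natDegree < G.dist u v) :
    |q.eval (k : ℝ) + σ u * σ v * q.eval (-k : ℝ)| ≤ Fintype.card V := by
  set A := G.adjMatrix ℝ
  set n : ℝ := (Fintype.card V : ℝ) with hn
  have : Nonempty V := ⟨u⟩
  have hnpos : 0 < n := by simp [hn, Fintype.card_pos]
  have hone : A *ᵥ (1 : V → ℝ) = (k : ℝ) • (1 : V → ℝ) := by
    ext w; simp [A, adjMatrix_mulVec_apply, hreg.degree_eq w]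
  have hσ : A *ᵥ σ = (-k : ℝ) • σ := by
    simpa using adjMatrix_mulVec_mul_of_alternating hadj hone
  have hsym : A.IsSymm := G.isSymm_adjMatrix
  have h1σ : ∑ i, σ i = 0 := by
    have h1 : (1 : V → ℝ) ⬝ᵥ (A *ᵥ σ) = (A *ᵥ 1) ⬝ᵥ σ := by
      rw [dotProduct_mulVec, ← mulVec_transpose, hsym.eq]
    rw [hσ, hone, dotProduct_smul, smul_dotProduct, smul_eq_mul, smul_eq_mul, one_dotProduct] at h1
    have : (0 : ℝ) < k := by exact_mod_cast hk
    nlinarith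
  have hσσ : σ ⬝ᵥ σ = n := by simp [dotProduct, hsq, hn]
  set e : V → ℝ := Pi.single v 1 with he
  set w : V → ℝ := e - n⁻¹ • 1 - (n⁻¹ * σ v) • σ with hw
  have hw1 : (1 : V → ℝ) ⬝ᵥ w = 0 := by
    simp [hw, he, dotProduct_sub, one_dotProduct, h1σ]
    field_simp
    simp [hn]
  have hwσ : σ ⬝ᵥ w = 0 := by
    rw [hw, dotProduct_sub, dotProduct_sub, dotProduct_smul, dotProduct_smul, hσσ,
      dotProduct_one, h1σ]
    simp [he]
    field_simp
    simp
  have hww : w ⬝ᵥ w ≤ 1 := by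
    have h1 : w ⬝ᵥ w = e ⬝ᵥ w := by
      nth_rewrite 1 [hw]
      simp [sub_dotProduct, hw1, hwσ]
    have h2 : e ⬝ᵥ w = 1 - n⁻¹ - n⁻¹ := by
      simp [he, hw, mul_assoc, hsq]
    have : 0 < n⁻¹ := by positivity
    linarith
  have hle := hsym.aeval_mulVec_dotProduct_self_le q w fun μ x hx hμ ↦ by
    have h1 : μ ≤ k := hreg.eigenvalue_le hx hμ
    have hσx := adjMatrix_mulVec_mul_of_alternating hadj hμ
    have hback : σ * (σ * x) = x := by
      ext i; simp [← mul_assoc, hsq]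
    have hσx0 : σ * x ≠ 0 := by
      intro h0
      rw [h0, mul_zero] at hback
      exact hx hback.symm
    have h2 : -μ ≤ k := hreg.eigenvalue_le hσx0 hσx
    rcases h1.eq_or_lt with rfl | h1
    · right
      have : x = x v • (1 : V → ℝ) := by
        ext i; simpa using hreg.eq_of_mulVec_eq_smul hconn hμ i v
      rw [this, smul_dotProduct, hw1, smul_zero]
    rcases h2.eq_or_lt with h2 | h2
    · right
      rw [h2] at hσx
      have : x = (σ v * x v) • σ := by
        ext i
        have hi := hreg.eq_of_mulVec_eq_smul hconn hσx i v
        simp only [Pi.mul_apply, Pi.smul_apply, smul_eq_mul] at hi ⊢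
        linear_combination σ i * hi - x i * hsq i
      rw [this, smul_dotProduct, hwσ, smul_zero]
    · exact .inl (hq μ ⟨x, hx, hμ⟩ (abs_lt.2 ⟨by linarith, h1⟩))
  set y := aeval A q *ᵥ w with hy
  have hyu : y u ^ 2 ≤ 1 := by
    refine le_trans ?_ (hle.trans hww)
    rw [sq]
    exact Finset.single_le_sum (f := fun i ↦ y i * y i) (fun i _ ↦ mul_self_nonneg _)
      (Finset.mem_univ u)
  have hyu' : y u = -(n⁻¹ * (q.eval (k : ℝ) + σ u * σ v * q.eval (-k : ℝ))) := by
    have h0 : (aeval A q *ᵥ e) u = 0 := by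
      simp [he, A, aeval_adjMatrix_apply_eq_zero huv]
    rw [hy, hw, mulVec_sub, mulVec_sub, mulVec_smul, mulVec_smul,
      aeval_mulVec_of_mulVec_eq_smul hone, aeval_mulVec_of_mulVec_eq_smul hσ]
    simp only [Pi.sub_apply, Pi.smul_apply, h0, smul_eq_mul, Pi.one_apply]
    ring
  rw [sq_le_one_iff_abs_le_one, hyu', abs_neg, abs_mul, abs_of_pos (by positivity)] at hyu
  rwa [inv_mul_le_iff₀ hnpos, mul_one] at hyu

end SimpleGraph

/-- Chung's diameter bound for connected bipartite `k`-regular graphs: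
`diam(G) ≤ 2 + log(n) / log((k + √(k² − λ²)) / λ)`. -/
theorem chung_diameter_bound_bipartite {V : Type*} [Fintype V]
    (G : SimpleGraph V) [DecidableRel G.Adj] (k : ℕ)
    (hconn : G.Connected) (hreg : G.IsRegularOfDegree k) (hbip : IsBipartite G)
    (lam : ℝ)
    (hlam : IsGreatest {x : ℝ | ∃ μ : ℝ, IsAdjEigenvalue G μ ∧ |μ| < k ∧ x = |μ|} lam)
    (hpos : 0 < lam) (hlt : lam < k) :
    (G.diam : ℝ) ≤ 2 + Real.log (Fintype.card V) /
      Real.log ((k + Real.sqrt (k ^ 2 - lam ^ 2)) / lam) := by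
  classical
  have hne : Nonempty V := hconn.nonempty
  have hkR : (0 : ℝ) < k := hpos.trans hlt
  have ht : 1 < k / lam := by rwa [one_lt_div hpos]
  have hx : ((k : ℝ) + √((k : ℝ) ^ 2 - lam ^ 2)) / lam = k / lam + √((k / lam) ^ 2 - 1) := by
    have : (k : ℝ) ^ 2 - lam ^ 2 = ((k / lam) ^ 2 - 1) * lam ^ 2 := by field_simp
    rw [this, Real.sqrt_mul' _ (sq_nonneg _), Real.sqrt_sq hpos.le]
    field_simp
  rw [hx]
  set x : ℝ := k / lam + √((k / lam) ^ 2 - 1) with hxdef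
  have hx1 : 1 < x := ht.trans_le (le_add_of_nonneg_right (Real.sqrt_nonneg _))
  have hlogx : 0 < Real.log x := Real.log_pos hx1
  have hcard : (1 : ℝ) ≤ Fintype.card V := by exact_mod_cast Fintype.card_pos
  have hlogn : 0 ≤ Real.log (Fintype.card V) := Real.log_nonneg hcard
  obtain ⟨u, v, huv⟩ := G.exists_dist_eq_diam
  by_cases hD : G.diam < 2
  · have : (G.diam : ℝ) ≤ 2 := by exact_mod_cast hD.le
    linarith [div_nonneg hlogn hlogx.le]
  obtain ⟨m, hm⟩ := Nat.exists_eq_add_of_le (not_lt.1 hD)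
  obtain ⟨s, hs⟩ := hbip
  set σ : V → ℝ := fun v ↦ if v ∈ s then 1 else -1 with hσ
  have hsq (v) : σ v * σ v = 1 := by by_cases h : v ∈ s <;> simp [hσ, h]
  have hadj ⦃u v⦄ (h : G.Adj u v) : σ v = -σ u := by
    have := hs h
    by_cases h1 : u ∈ s <;> by_cases h2 : v ∈ s <;> simp_all
  obtain ⟨p, hp⟩ := hconn.exists_walk_length_eq_dist u v
  have hσuv : σ u * σ v = (-1) ^ m := by
    rw [p.alternating_eq hadj, hp, huv, hm, mul_left_comm, hsq, pow_add]
    norm_num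
  set q : Polynomial ℝ :=
    (Polynomial.Chebyshev.T ℝ m).comp (Polynomial.C lam⁻¹ * Polynomial.X) with hq
  have heval (μ : ℝ) : q.eval μ = (Polynomial.Chebyshev.T ℝ m).eval (μ / lam) := by
    simp [hq, div_eq_inv_mul]
  have hdeg : q.natDegree < G.dist u v := by
    rw [hq, Polynomial.natDegree_comp, Polynomial.natDegree_C_mul_X _ (inv_ne_zero hpos.ne'),
      Polynomial.Chebyshev.natDegree_T, huv, hm]
    simp
  have hbound := hreg.abs_eval_add_eval_neg_le (by exact_mod_cast hkR) hconn hsq hadj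
    (q := q) (fun μ hμ hμk ↦ by
      rw [heval]
      refine Polynomial.Chebyshev.abs_eval_T_real_le_one _ ?_
      rw [abs_div, abs_of_pos hpos, div_le_one hpos]
      exact hlam.2 ⟨μ, hμ, hμk, rfl⟩) hdeg
  rw [heval, heval, neg_div, Polynomial.Chebyshev.T_eval_neg, hσuv, ← mul_assoc] at hbound
  have hsign : (-1 : ℝ) ^ m * ((m : ℤ).negOnePow : ℤ) = 1 := by
    rw [Int.negOnePow_def]
    simp [← mul_pow]
  rw [hsign, one_mul, ← two_mul] at hbound
  have hpow : x ^ m ≤ Fintype.card V :=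
    (Polynomial.Chebyshev.pow_le_two_mul_eval_T ht.le m).trans ((le_abs_self _).trans hbound)
  have hlog := Real.log_le_log (by positivity) hpow
  rw [Real.log_pow, ← le_div_iff₀ hlogx] at hlog
  rw [hm]
  push_cast
  linarith
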